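/- Assume (H1), (H2), (H3″) (i.e. α̲_Γ := inf_{x̄∈Γ} α̲_{δ_Γ}(x̄) > −t), upper Ahlfors regularity (H4′) and H^t(Γ) < ∞, and put β₀ := (α̲_Γ + t)/p > 0. Let 0 < β < β₀. Then there is a constant C < ∞, independent of u, such that for every u ∈ N^{s,p}(Ω) and every H^t-measurable Tu : Γ → ℝ with the property that for H^t-almost every x̄ ∈ Γ, g(x;u) → Tu(x̄) as x → x̄ with x ∈ Q_{λ₀}(x̄), one has Tu ∈ W^{β,p}(Γ) and ( ∫_Γ |Tu|ᵖ dH^t )^{1/p} + ( ∫_Γ∫_Γ |Tu(ȳ) − Tu(x̄)|ᵖ/‖ȳ − x̄‖^{t+βp} dH^t(ȳ) dH^t(x̄) )^{1/p} ≤ C ( ‖u‖_{L¹(Ω)} + ν(Ω;u)^{1/p} ). -/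

import Mathlib

open MeasureTheory Metric Set Filter
open scoped ENNReal NNReal Topology

noncomputable section

abbrev Euc (n : ℕ) := EuclideanSpace ℝ (Fin n)

variable {n : ℕ}

/-- Distance to the boundary of `Ω`. -/
def dB (Ω : Set (Euc n)) (x : Euc n) : ℝ := infDist x (frontier Ω)

/-- `Ψ(x) = B(x, d(x)/2)`. -/
def PsiB (Ω : Set (Euc n)) (x : Euc n) : Set (Euc n) := ball x (dB Ω x / 2)

/-- `Φ(x) = B(x, d(x)/6)`. -/
def PhiB (Ω : Set (Euc n)) (x : Euc n) : Set (Euc n) := ball x (dB Ω x / 6)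

/-- The integrand of `ν(·;u)`. -/
def nuInt (Ω : Set (Euc n)) (s : Euc n → ℝ) (p : ℝ) (u : Euc n → ℝ) (x : Euc n) : ℝ :=
  (⨍ y in PsiB Ω x, |u y - u x|) ^ p * dB Ω x ^ (-(p * s x))

/-- `ν(E;u)`. -/
def nuM (Ω : Set (Euc n)) (s : Euc n → ℝ) (p : ℝ) (u : Euc n → ℝ) (E : Set (Euc n)) : ℝ :=
  ∫ x in Ω ∩ E, nuInt Ω s p u x

/-- Membership in the nonlocal space `𝒩^{s,p}(Ω)`: `u ∈ L¹(Ω)` and `ν(Ω;u) < ∞`. -/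
def MemN (Ω : Set (Euc n)) (s : Euc n → ℝ) (p : ℝ) (u : Euc n → ℝ) : Prop :=
  IntegrableOn u Ω volume ∧ IntegrableOn (nuInt Ω s p u) Ω volume

/-- `g(x;u)`, the mean of `u` over `Φ(x)`. -/
def gFun (Ω : Set (Euc n)) (u : Euc n → ℝ) (x : Euc n) : ℝ := ⨍ y in PhiB Ω x, u y

/-- The approach region `Q^θ_λ(xb)`. -/
def Qreg (Ω : Set (Euc n)) (lam θ : ℝ) (xb : Euc n) : Set (Euc n) :=
  {x | x ∈ Ω ∧ (lam * dist xb x) ^ θ < dB Ω x}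

/-- `Q` is an `(η,θ)`-corkscrew region for `xb` with radius `δ₀`. -/
def IsCorkscrew (Ω Q : Set (Euc n)) (xb : Euc n) (η θ δ₀ : ℝ) : Prop :=
  ∀ δ : ℝ, 0 < δ → δ ≤ δ₀ →
    ∃ x ∈ Q, η * δ < dist xb x ∧ dist xb x < δ ∧ (η * δ) ^ θ < dB Ω x

/-- `E` is `(C,θ)`-connected to `xb`, with radius `ρ₀` and gauge `ε`. -/
def ConnectedTo (Ω E : Set (Euc n)) (xb : Euc n) (C θ ρ₀ : ℝ) (ε : ℝ → ℝ) : Prop :=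
  ∀ lam : ℝ, 0 < lam → lam < 1 →
    0 < ε lam ∧ ε lam ≤ lam ∧
      ∀ ρ : ℝ, 0 < ρ → ρ ≤ ρ₀ → ∀ x ∈ E ∩ ball xb ρ, ∀ x' ∈ E ∩ ball xb ρ,
        (lam * ρ) ^ θ ≤ dB Ω x → (lam * ρ) ^ θ ≤ dB Ω x' →
        ∃ γ : ℝ → Euc n, ContinuousOn γ (Icc 0 1) ∧ γ 0 = x ∧ γ 1 = x' ∧
          (∀ τ ∈ Icc (0:ℝ) 1, γ τ ∈ E ∧ ε lam * ρ ^ θ ≤ dB Ω (γ τ)) ∧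
          eVariationOn γ (Icc 0 1) ≤ ENNReal.ofReal (C * ρ)

/-- The piecewise bilinear function `α(s,θ)`. -/
def alphaFun (n : ℕ) (p sv θ : ℝ) : ℝ :=
  if p * sv - n ≤ p - 1 then p * (1 - θ) + (p * sv - n) * θ
  else (1 - θ) + (p * sv - n)

/-- `s̲_δ(xb)`. -/
def sLow (Ω : Set (Euc n)) (s : Euc n → ℝ) (xb : Euc n) (δ : ℝ) : ℝ :=
  sInf (s '' (Ω ∩ ball xb δ))

/-- `α̲_δ(xb)`. -/
def alphaLow (Ω : Set (Euc n)) (s : Euc n → ℝ) (p : ℝ) (θΓ : Euc n → ℝ)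
    (xb : Euc n) (δ : ℝ) : ℝ :=
  alphaFun n p (sLow Ω s xb δ) (θΓ xb)

/-- `α̲_0(xb) = lim_{δ → 0⁺} α̲_δ(xb)`. -/
def alphaLow0 (Ω : Set (Euc n)) (s : Euc n → ℝ) (p : ℝ) (θΓ : Euc n → ℝ) (xb : Euc n) : ℝ :=
  limUnder (𝓝[>] (0:ℝ)) (fun δ => alphaLow Ω s p θΓ xb δ)

/-- `Γ_τ`: points of `Γ` where `limsup_{ρ→0⁺} ρ^{-τ} ν(B(xb,ρ);u) < ∞`. -/
def GammaTau (Ω : Set (Euc n)) (s : Euc n → ℝ) (p : ℝ) (u : Euc n → ℝ)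
    (Γ : Set (Euc n)) (τ : ℝ) : Set (Euc n) :=
  {xb ∈ Γ | ∃ M : ℝ, ∀ᶠ ρ in 𝓝[>] (0:ℝ), ρ ^ (-τ) * nuM Ω s p u (ball xb ρ) ≤ M}

/-- `M_τ(xb) = sup_{0<ρ≤δΓ} ρ^{-τ} ν(B(xb,ρ);u)`. -/
def Mtau (Ω : Set (Euc n)) (s : Euc n → ℝ) (p : ℝ) (u : Euc n → ℝ)
    (δΓ τ : ℝ) (xb : Euc n) : ℝ :=
  sSup ((fun ρ => ρ ^ (-τ) * nuM Ω s p u (ball xb ρ)) '' Ioc 0 δΓ)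

section geom

lemma dB_nonneg (Ω : Set (Euc n)) (x : Euc n) : 0 ≤ dB Ω x := infDist_nonneg

lemma dB_le_add (Ω : Set (Euc n)) (x y : Euc n) : dB Ω x ≤ dB Ω y + dist x y :=
  infDist_le_infDist_add_dist

lemma dB_le_dist {Ω : Set (Euc n)} {xb : Euc n} (h : xb ∈ frontier Ω) (x : Euc n) :
    dB Ω x ≤ dist x xb := infDist_le_dist_of_mem h

lemma dB_pos {Ω : Set (Euc n)} (hΩo : IsOpen Ω) (hfr : (frontier Ω).Nonempty)
    {x : Euc n} (hx : x ∈ Ω) : 0 < dB Ω x := by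
  refine (isClosed_frontier.notMem_iff_infDist_pos hfr).1 ?_
  intro h
  exact (hΩo.inter_frontier_eq ▸ (⟨hx, h⟩ : x ∈ Ω ∩ frontier Ω) : x ∈ (∅ : Set (Euc n)))

lemma ball_dB_subset {Ω : Set (Euc n)} (hΩo : IsOpen Ω) {x : Euc n} (hx : x ∈ Ω) :
    ball x (dB Ω x) ⊆ Ω := by
  by_contra hcon
  obtain ⟨y, hy, hyΩ⟩ := not_subset.1 hcon
  have hpre : IsPreconnected (ball x (dB Ω x)) := (convex_ball x _).isPreconnected
  have hpos : 0 < dB Ω x := pos_of_mem_ball hy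
  have hcl : ∀ z ∈ ball x (dB Ω x), z ∉ Ω → z ∈ (closure Ω)ᶜ := by
    intro z hz hzΩ hzc
    have hzf : z ∈ frontier Ω := by
      rw [frontier, hΩo.interior_eq]; exact ⟨hzc, hzΩ⟩
    have := dB_le_dist hzf x
    rw [mem_ball, dist_comm] at hz
    linarith
  obtain ⟨z, _, hz1, hz2⟩ := hpre Ω (closure Ω)ᶜ hΩo isClosed_closure.isOpen_compl
    (fun z hz => by
      by_cases h : z ∈ Ω
      · exact Or.inl h
      · exact Or.inr (hcl z hz h))
    ⟨x, mem_ball_self hpos, hx⟩ ⟨y, hy, hcl y hy hyΩ⟩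
  exact hz2 (subset_closure hz1)

lemma avg_le {x y : Euc n} {r R : ℝ} (hr : 0 < r) (hsub : ball x r ⊆ ball y R)
    (hR : R ≤ 4 * r) {u : Euc n → ℝ} (hu : IntegrableOn u (ball y R)) (c : ℝ) :
    |(⨍ z in ball x r, u z) - c| ≤ 4 ^ n * ⨍ z in ball y R, |u z - c| := by
  have hR0 : 0 < R := by
    by_contra h
    have h1 := hsub (mem_ball_self hr)
    rw [ball_eq_empty.2 (not_lt.1 h)] at h1
    exact h1
  set ω := volume.real (ball (0 : Euc n) 1) with hω
  have hω0 : 0 < ω := ENNReal.toReal_pos (measure_ball_pos _ _ one_pos).ne' measure_ball_lt_top.ne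
  have hv : ∀ (z : Euc n) (ρ : ℝ), 0 < ρ → volume.real (ball z ρ) = ρ ^ n * ω := by
    intro z ρ hρ
    rw [hω, Measure.real, Measure.addHaar_ball_of_pos _ _ hρ, ENNReal.toReal_mul,
      ENNReal.toReal_ofReal (by positivity), finrank_euclideanSpace_fin]; rfl
  have hux : IntegrableOn u (ball x r) := hu.mono_set hsub
  have hci : ∀ (z : Euc n) (ρ : ℝ), IntegrableOn (fun _ => c) (ball z ρ) volume := fun z ρ =>
    integrableOn_const measure_ball_lt_top.ne
  have e1 : (⨍ z in ball x r, u z) - c = (r ^ n * ω)⁻¹ * ∫ z in ball x r, (u z - c) := by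
    rw [setAverage_eq, hv x r hr, integral_sub hux (hci x r), setIntegral_const, hv x r hr]
    have : r ^ n * ω ≠ 0 := by positivity
    simp only [smul_eq_mul]
    field_simp
  have hintg : IntegrableOn (fun z => |u z - c|) (ball y R) := (hu.sub (hci y R)).abs
  rw [e1, abs_mul, abs_of_pos (by positivity), setAverage_eq, hv y R hR0, smul_eq_mul]
  have e2 : |∫ z in ball x r, (u z - c)| ≤ ∫ z in ball y R, |u z - c| :=
    (abs_integral_le_integral_abs).trans
      (setIntegral_mono_set hintg (ae_of_all _ fun _ => abs_nonneg _) hsub.eventuallyLE)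
  set I := ∫ z in ball y R, |u z - c| with hI
  have hI0 : 0 ≤ I := (abs_nonneg _).trans e2
  have e3 : R ^ n ≤ 4 ^ n * r ^ n := by
    rw [← mul_pow]; exact pow_le_pow_left₀ hR0.le hR n
  calc (r ^ n * ω)⁻¹ * |∫ z in ball x r, (u z - c)| ≤ (r ^ n * ω)⁻¹ * I := by gcongr
    _ ≤ (4 ^ n * (R ^ n * ω)⁻¹) * I := by
        gcongr
        rw [← div_eq_mul_inv, inv_eq_one_div, div_le_div_iff₀ (by positivity) (by positivity)]
        nlinarith
    _ = _ := by ring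

/-- The measure `ν(·;u)`. -/
def NM (Ω : Set (Euc n)) (s : Euc n → ℝ) (p : ℝ) (u : Euc n → ℝ) : Measure (Euc n) :=
  (volume.restrict Ω).withDensity (fun x => ENNReal.ofReal (nuInt Ω s p u x))

lemma nuInt_nonneg (Ω : Set (Euc n)) (s : Euc n → ℝ) (p : ℝ) (u : Euc n → ℝ) (x : Euc n) :
    0 ≤ nuInt Ω s p u x := by
  unfold nuInt
  refine mul_nonneg (Real.rpow_nonneg ?_ _) (Real.rpow_nonneg (dB_nonneg _ _) _)
  rw [setAverage_eq]
  exact smul_nonneg (by positivity) (integral_nonneg fun _ => abs_nonneg _)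

lemma NM_univ {Ω : Set (Euc n)} {s : Euc n → ℝ} {p : ℝ} {u : Euc n → ℝ} (h : MemN Ω s p u) :
    NM Ω s p u univ = ENNReal.ofReal (nuM Ω s p u univ) := by
  rw [NM, withDensity_apply _ MeasurableSet.univ, nuM, inter_univ, Measure.restrict_univ,
    ofReal_integral_eq_lintegral_ofReal h.2 (ae_of_all _ fun x => nuInt_nonneg _ _ _ _ _)]

lemma NM_fin {Ω : Set (Euc n)} {s : Euc n → ℝ} {p : ℝ} {u : Euc n → ℝ} (h : MemN Ω s p u) :
    IsFiniteMeasure (NM Ω s p u) :=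
  ⟨by rw [NM_univ h]; exact ENNReal.ofReal_lt_top⟩

lemma local_step {Ω : Set (Euc n)} (hΩo : IsOpen Ω) (hfr : (frontier Ω).Nonempty)
    {u : Euc n → ℝ} (hu : IntegrableOn u Ω) {x x' : Euc n} (hx : x ∈ Ω)
    (hd : dist x x' ≤ dB Ω x / 12) {y : Euc n} (hy : y ∈ ball x (dB Ω x / 12)) :
    |gFun Ω u x - gFun Ω u x'| ≤ 2 * 4 ^ n * ⨍ z in PsiB Ω y, |u z - u y| := by
  have hdx := dB_pos hΩo hfr hx
  rw [mem_ball] at hy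
  have h1 := dB_le_add Ω x' x
  have h2 := dB_le_add Ω x x'
  have h3 := dB_le_add Ω y x
  have h4 := dB_le_add Ω x y
  rw [dist_comm x' x] at h1
  rw [dist_comm x y] at h4
  have hyΩ : y ∈ Ω := ball_dB_subset hΩo hx (by rw [mem_ball]; linarith)
  have hintg : IntegrableOn u (ball y (dB Ω y / 2)) := hu.mono_set
    ((ball_subset_ball (by linarith [dB_nonneg Ω y])).trans (ball_dB_subset hΩo hyΩ))
  have a1 := avg_le (x := x) (y := y) (r := dB Ω x / 6) (R := dB Ω y / 2) (by linarith)
    (ball_subset_ball' (by rw [dist_comm]; linarith)) (by linarith) hintg (u y)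
  have a2 := avg_le (x := x') (y := y) (r := dB Ω x' / 6) (R := dB Ω y / 2) (by linarith)
    (ball_subset_ball' (by
      have := dist_triangle x' x y
      rw [dist_comm x' x, dist_comm x y] at this; linarith)) (by linarith) hintg (u y)
  unfold gFun PhiB PsiB
  have := abs_sub_le (⨍ y in ball x (dB Ω x / 6), u y) (u y) (⨍ y in ball x' (dB Ω x' / 6), u y)
  rw [abs_sub_comm (u y)] at this
  linarith

end geom

section chain

/-- Constant of the local estimate. -/
def Kloc (n : ℕ) (p b : ℝ) : ℝ :=
  (2 * 4 ^ n) ^ p * 2 ^ (p * b) * (12 ^ n / volume.real (ball (0 : Euc n) 1))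

lemma omega_pos (n : ℕ) : 0 < volume.real (ball (0 : Euc n) 1) :=
  ENNReal.toReal_pos (measure_ball_pos _ _ one_pos).ne' measure_ball_lt_top.ne

lemma Kloc_pos (n : ℕ) (p b : ℝ) : 0 < Kloc n p b := by
  have := omega_pos n
  unfold Kloc
  positivity

lemma local_est {Ω : Set (Euc n)} (hΩo : IsOpen Ω) (hfr : (frontier Ω).Nonempty)
    {s : Euc n → ℝ} {p : ℝ} (hp : 1 ≤ p) {u : Euc n → ℝ} (hu : MemN Ω s p u) {x x' : Euc n}
    (hx : x ∈ Ω) (hd : dist x x' ≤ dB Ω x / 12) {σ b : ℝ} (hσ : 0 ≤ σ) (hσb : σ ≤ b)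
    (hs : ∀ y ∈ ball x (dB Ω x / 12), σ ≤ s y ∧ dB Ω y ≤ 1) :
    |gFun Ω u x - gFun Ω u x'| ^ p ≤
      Kloc n p b * dB Ω x ^ (p * σ - n) * (NM Ω s p u).real (ball x (dB Ω x / 12)) := by
  have := NM_fin hu
  have hdx := dB_pos hΩo hfr hx
  have hω := omega_pos n
  set d := dB Ω x with hd_def
  set Δ := |gFun Ω u x - gFun Ω u x'| with hΔ
  set B := ball x (d / 12) with hB
  have hΔ0 : 0 ≤ Δ := abs_nonneg _
  set c0 : ℝ := (2 * 4 ^ n) ^ p * (2 ^ (p * b) * d ^ (p * σ)) with hc0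
  have hc00 : 0 ≤ c0 := by positivity
  have hBΩ : B ⊆ Ω := (ball_subset_ball (by linarith)).trans (ball_dB_subset hΩo hx)
  have key : ∀ y ∈ B, Δ ^ p ≤ c0 * nuInt Ω s p u y := by
    intro y hy
    have hstep := local_step hΩo hfr hu.1 hx hd hy
    have hyΩ := hBΩ hy
    have hdy := dB_pos hΩo hfr hyΩ
    obtain ⟨hs1, hs2⟩ := hs y hy
    set G := ⨍ z in PsiB Ω y, |u z - u y| with hG
    have hG0 : 0 ≤ G := by
      rw [hG, setAverage_eq]
      exact smul_nonneg (by positivity) (integral_nonneg fun _ => abs_nonneg _)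
    have e1 : G ^ p = nuInt Ω s p u y * dB Ω y ^ (p * s y) := by
      unfold nuInt
      rw [mul_assoc, ← Real.rpow_add hdy]
      simp [hG]
    have e2 : dB Ω y ^ (p * s y) ≤ 2 ^ (p * b) * d ^ (p * σ) := by
      calc dB Ω y ^ (p * s y) ≤ dB Ω y ^ (p * σ) :=
            Real.rpow_le_rpow_of_exponent_ge hdy hs2 (by gcongr)
        _ ≤ (2 * d) ^ (p * σ) := by
            refine Real.rpow_le_rpow hdy.le ?_ (by positivity)
            have h3 := dB_le_add Ω y x
            rw [hB, mem_ball] at hy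
            linarith
        _ = 2 ^ (p * σ) * d ^ (p * σ) := Real.mul_rpow (by norm_num) hdx.le
        _ ≤ _ := by
            gcongr
            norm_num
    calc Δ ^ p ≤ (2 * 4 ^ n * G) ^ p := Real.rpow_le_rpow hΔ0 hstep (by linarith)
      _ = (2 * 4 ^ n) ^ p * G ^ p := Real.mul_rpow (by positivity) hG0
      _ = (2 * 4 ^ n) ^ p * (nuInt Ω s p u y * dB Ω y ^ (p * s y)) := by rw [e1]
      _ ≤ (2 * 4 ^ n) ^ p * (nuInt Ω s p u y * (2 ^ (p * b) * d ^ (p * σ))) := by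
          gcongr
          exact nuInt_nonneg _ _ _ _ _
      _ = _ := by rw [hc0]; ring
  have hE : ENNReal.ofReal (Δ ^ p) * volume B ≤ ENNReal.ofReal c0 * NM Ω s p u B := by
    rw [NM, withDensity_apply _ measurableSet_ball, Measure.restrict_restrict measurableSet_ball,
      inter_eq_left.2 hBΩ, ← lintegral_const_mul' _ _ ENNReal.ofReal_ne_top, ← setLIntegral_const]
    refine setLIntegral_mono' measurableSet_ball fun y hy => ?_
    rw [← ENNReal.ofReal_mul hc00]
    exact ENNReal.ofReal_le_ofReal (key y hy)
  have hR : Δ ^ p * volume.real B ≤ c0 * (NM Ω s p u).real B := by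
    have := ENNReal.toReal_mono (ENNReal.mul_ne_top ENNReal.ofReal_ne_top (measure_ne_top _ _)) hE
    rwa [ENNReal.toReal_mul, ENNReal.toReal_mul, ENNReal.toReal_ofReal (by positivity),
      ENNReal.toReal_ofReal hc00] at this
  have hvol : volume.real B = (d / 12) ^ n * volume.real (ball (0 : Euc n) 1) := by
    rw [hB, Measure.real, Measure.addHaar_ball_of_pos _ _ (by positivity), ENNReal.toReal_mul,
      ENNReal.toReal_ofReal (by positivity), finrank_euclideanSpace_fin]; rfl
  rw [hvol] at hR
  have hK : Kloc n p b = (2 * 4 ^ n) ^ p * 2 ^ (p * b) * (12 ^ n / volume.real (ball (0 : Euc n) 1)) := rfl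
  set ω := volume.real (ball (0 : Euc n) 1)
  set V := (NM Ω s p u).real B
  have hpos : 0 < (d / 12) ^ n * ω := by positivity
  rw [← le_div_iff₀ hpos] at hR
  refine hR.trans (le_of_eq ?_)
  rw [hc0, hK, Real.rpow_sub hdx, Real.rpow_natCast, div_pow]
  field_simp

lemma chain_est {X : Type*} [PseudoMetricSpace X] (γ : ℝ → X) (hγ : ContinuousOn γ (Icc 0 1))
    (f D : X → ℝ) {h M L R : ℝ} (hh : 0 < h) (hM : 0 ≤ M)
    (hD : ∀ τ ∈ Icc (0:ℝ) 1, h ≤ D (γ τ) ∧ D (γ τ) ≤ R)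
    (hL0 : 0 ≤ L) (hL : eVariationOn γ (Icc 0 1) ≤ ENNReal.ofReal L)
    (hf : ∀ τ ∈ Icc (0:ℝ) 1, ∀ τ' ∈ Icc (0:ℝ) 1, dist (γ τ) (γ τ') ≤ D (γ τ) / 12 →
      |f (γ τ) - f (γ τ')| ≤ M * D (γ τ)) :
    |f (γ 0) - f (γ 1)| ≤ M * (12 * L + R) := by
  have claim : ∀ N : ℕ, ∀ τ ∈ Icc (0:ℝ) 1, ∀ l : ℝ, 0 ≤ l → l < N * (h / 12) →
      eVariationOn γ (Icc τ 1) ≤ ENNReal.ofReal l →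
      |f (γ τ) - f (γ 1)| ≤ M * (12 * l + R) := by
    intro N
    induction N with
    | zero =>
      intro τ _ l hl hl2
      simp at hl2; linarith
    | succ N ih =>
      intro τ hτ l hl hlN hvar
      obtain ⟨hD1, hD2⟩ := hD τ hτ
      have h1m : (1:ℝ) ∈ Icc (0:ℝ) 1 := by simp
      by_cases hc : dist (γ τ) (γ 1) ≤ D (γ τ) / 12
      · have := hf τ hτ 1 h1m hc
        have h2 : M * D (γ τ) ≤ M * R := by gcongr
        have : 0 ≤ M * (12 * l) := by positivity
        linarith
      · push Not at hc
        have hcont : ContinuousOn (fun r => dist (γ τ) (γ r)) (Icc τ 1) := by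
          have hγ' := hγ.mono (Icc_subset_Icc_left hτ.1 : Icc τ 1 ⊆ Icc 0 1)
          fun_prop
        have hivt := intermediate_value_Icc hτ.2 hcont
        obtain ⟨r, hr, hre⟩ := hivt (show D (γ τ) / 12 ∈ _ from
          ⟨by simp only [dist_self]; linarith, hc.le⟩)
        simp only at hre
        have hr01 : r ∈ Icc (0:ℝ) 1 := ⟨hτ.1.trans hr.1, hr.2⟩
        have hadd := eVariationOn.Icc_add_Icc γ (s := univ) hr.1 hr.2 (mem_univ _)
        simp only [univ_inter] at hadd
        have hed := eVariationOn.edist_le γ (s := Icc τ r) (left_mem_Icc.2 hr.1)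
          (right_mem_Icc.2 hr.1)
        rw [edist_dist, hre] at hed
        have hle : ENNReal.ofReal (D (γ τ) / 12) + eVariationOn γ (Icc r 1) ≤
            ENNReal.ofReal l := by
          calc _ ≤ eVariationOn γ (Icc τ r) + eVariationOn γ (Icc r 1) := by gcongr
            _ = _ := hadd
            _ ≤ _ := hvar
        have hle1 : D (γ τ) / 12 ≤ l :=
          (ENNReal.ofReal_le_ofReal_iff hl).1 (le_self_add.trans hle)
        have hle2 : eVariationOn γ (Icc r 1) ≤ ENNReal.ofReal (l - D (γ τ) / 12) := by
          rw [ENNReal.ofReal_sub _ (by linarith)]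
          exact ENNReal.le_sub_of_add_le_left ENNReal.ofReal_ne_top hle
        have i1 := ih r hr01 (l - D (γ τ) / 12) (by linarith) (by push_cast at hlN; linarith) hle2
        have i2 := hf τ hτ r hr01 hre.le
        have i3 := abs_sub_le (f (γ τ)) (f (γ r)) (f (γ 1))
        linarith
  obtain ⟨N, hN⟩ := exists_nat_gt (L / (h / 12))
  exact claim N 0 (by simp) L hL0 ((div_lt_iff₀ (by positivity)).1 hN) hL

end chain

section keyest

lemma weight_est (n : ℕ) {p σ b θ ρ ε0 K : ℝ} (hp : 1 ≤ p) (hσ : 0 ≤ σ) (hσb : σ ≤ b)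
    (hθ : 1 ≤ θ) (hρ : 0 < ρ) (hρ1 : ρ ≤ 1) (hε : 0 < ε0) (hε1 : ε0 ≤ 1) (hK : 1 ≤ K) :
    ∃ W : ℝ, 0 ≤ W ∧ (∀ d, ε0 * ρ ^ θ ≤ d → d ≤ K * ρ → d ^ (σ - n / p - 1) ≤ W) ∧
      (W * ρ) ^ p ≤ (ε0 ^ (-(p + n)) + K ^ (p * b)) * ρ ^ alphaFun n p σ θ := by
  have hp0 : 0 < p := by linarith
  have hep : (σ - n / p - 1) * p = p * σ - n - p := by field_simp
  set e := σ - n / p - 1 with he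
  have hn0 : (0:ℝ) ≤ n := by positivity
  have hpσ : 0 ≤ p * σ := by positivity
  have hρθ : 0 < ε0 * ρ ^ θ := by positivity
  by_cases hc : e ≤ 0
  · refine ⟨(ε0 * ρ ^ θ) ^ e, by positivity, fun d h1 h2 => ?_, ?_⟩
    · exact Real.rpow_le_rpow_of_nonpos hρθ h1 hc
    · have h1 : ((ε0 * ρ ^ θ) ^ e * ρ) ^ p = ε0 ^ (e * p) * ρ ^ (θ * (e * p) + p) := by
        rw [Real.mul_rpow (by positivity) hρ.le, Real.mul_rpow hε.le (by positivity),
          Real.mul_rpow (by positivity) (by positivity), ← Real.rpow_mul hε.le,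
          ← Real.rpow_mul hρ.le, ← Real.rpow_mul hρ.le, Real.rpow_add hρ]
        ring_nf
      rw [h1]
      refine mul_le_mul ?_ ?_ (by positivity) (by positivity)
      · have : ε0 ^ (e * p) ≤ ε0 ^ (-(p + n)) :=
          Real.rpow_le_rpow_of_exponent_ge hε hε1 (by rw [hep]; linarith)
        have : 0 ≤ K ^ (p * b) := by positivity
        linarith
      · refine Real.rpow_le_rpow_of_exponent_ge hρ hρ1 ?_
        rw [hep]
        unfold alphaFun
        split_ifs with h
        · nlinarith
        · push Not at h
          nlinarith
  · push Not at hc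
    refine ⟨(K * ρ) ^ e, by positivity, fun d h1 h2 => ?_, ?_⟩
    · exact Real.rpow_le_rpow (by linarith) h2 hc.le
    · have h1 : ((K * ρ) ^ e * ρ) ^ p = K ^ (e * p) * ρ ^ (e * p + p) := by
        rw [Real.mul_rpow (by positivity) hρ.le, Real.mul_rpow (by positivity) hρ.le,
          Real.mul_rpow (by positivity) (by positivity), ← Real.rpow_mul (by positivity),
          ← Real.rpow_mul hρ.le, Real.rpow_add hρ]
        ring_nf
      rw [h1]
      have hep0 : 0 < e * p := by positivity
      refine mul_le_mul ?_ ?_ (by positivity) (by positivity)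
      · have : K ^ (e * p) ≤ K ^ (p * b) :=
          Real.rpow_le_rpow_of_exponent_le hK (by rw [hep]; nlinarith)
        have : 0 ≤ ε0 ^ (-(p + n)) := by positivity
        linarith
      · refine Real.rpow_le_rpow_of_exponent_ge hρ hρ1 ?_
        rw [hep] at hep0 ⊢
        unfold alphaFun
        split_ifs with h
        · linarith
        · linarith

/-- Constant of the key estimate. -/
def Kkey (n : ℕ) (p b CΓ ε0 : ℝ) : ℝ :=
  Kloc n p b * (13 * (1 + CΓ)) ^ p * (ε0 ^ (-(p + n)) + (1 + CΓ) ^ (p * b))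

lemma sLow_le {Ω : Set (Euc n)} {s : Euc n → ℝ} (hs0 : ∀ x, 0 ≤ s x) {xb y : Euc n} {δ : ℝ}
    (hy : y ∈ Ω ∩ ball xb δ) : sLow Ω s xb δ ≤ s y :=
  csInf_le ⟨0, by rintro _ ⟨z, _, rfl⟩; exact hs0 z⟩ ⟨y, hy, rfl⟩

lemma sLow_nonneg {Ω : Set (Euc n)} {s : Euc n → ℝ} (hs0 : ∀ x, 0 ≤ s x) (xb : Euc n) (δ : ℝ) :
    0 ≤ sLow Ω s xb δ :=
  Real.sInf_nonneg (by rintro _ ⟨z, _, rfl⟩; exact hs0 z)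

lemma key_est {Ω : Set (Euc n)} (hΩo : IsOpen Ω)
    {s : Euc n → ℝ} (hs0 : ∀ x, 0 ≤ s x) {b : ℝ} (hsb : ∀ x, s x ≤ b)
    {p : ℝ} (hp : 1 ≤ p) {u : Euc n → ℝ} (hu : MemN Ω s p u)
    {CΓ δΓ : ℝ} (hCΓ : 1 ≤ CΓ) (hδΓ0 : 0 < δΓ) (hδΓ1 : δΓ < 1) {xb : Euc n}
    (hxb : xb ∈ frontier Ω) {θΓ : Euc n → ℝ} (hθ : 1 ≤ θΓ xb) {ε : ℝ → ℝ}
    (H2 : ConnectedTo Ω (Ω ∩ ball xb δΓ) xb CΓ (θΓ xb) (δΓ / (3 * CΓ)) ε)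
    {a : ℝ} (ha : a ≤ alphaLow Ω s p θΓ xb δΓ)
    {lam ρ : ℝ} (hlam : 0 < lam) (hlam1 : lam < 1) (hρ : 0 < ρ) (hρ1 : ρ ≤ δΓ / (3 * CΓ))
    {x x' : Euc n} (hx : x ∈ Ω) (hx' : x' ∈ Ω) (hxρ : dist x xb < ρ) (hxρ' : dist x' xb < ρ)
    (hdx : (lam * ρ) ^ θΓ xb ≤ dB Ω x) (hdx' : (lam * ρ) ^ θΓ xb ≤ dB Ω x') :
    |gFun Ω u x - gFun Ω u x'| ^ p ≤
      Kkey n p b CΓ (ε lam) * ρ ^ a * (NM Ω s p u).real (ball xb (2 * (1 + CΓ) * ρ)) := by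
  have hp0 : 0 < p := by linarith
  have hfin := NM_fin hu
  have hfr : (frontier Ω).Nonempty := ⟨xb, hxb⟩
  have hCρ : CΓ * ρ ≤ δΓ / 3 := by
    rw [le_div_iff₀ (by positivity)] at hρ1; linarith
  have hρδ : ρ ≤ δΓ / 3 := by nlinarith
  obtain ⟨hε0, hεlam, H⟩ := H2 lam hlam hlam1
  obtain ⟨γ, hγc, hγ0, hγ1, hγ, hvar⟩ := H ρ hρ hρ1 x ⟨⟨hx, by rw [mem_ball]; linarith⟩, hxρ⟩
    x' ⟨⟨hx', by rw [mem_ball]; linarith⟩, hxρ'⟩ hdx hdx'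
  set σ := sLow Ω s xb δΓ with hσ
  have hσ0 : 0 ≤ σ := sLow_nonneg hs0 _ _
  have hσb : σ ≤ b := (sLow_le hs0 ⟨hx, by rw [mem_ball]; linarith⟩).trans (hsb x)
  obtain ⟨W, hW0, hW, hWρ⟩ := weight_est n hp hσ0 hσb hθ hρ (by linarith : ρ ≤ 1) hε0
    (by linarith) (by linarith : 1 ≤ 1 + CΓ)
  set V := (NM Ω s p u).real (ball xb (2 * (1 + CΓ) * ρ)) with hV
  have hV0 : 0 ≤ V := measureReal_nonneg
  have hK0 := Kloc_pos n p b
  have hdist : ∀ τ ∈ Icc (0:ℝ) 1, dist (γ τ) xb < (1 + CΓ) * ρ := by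
    intro τ hτ
    have h1 := (eVariationOn.edist_le γ (s := Icc (0:ℝ) 1) hτ (left_mem_Icc.2 zero_le_one)).trans hvar
    rw [edist_dist, ENNReal.ofReal_le_ofReal_iff (by positivity), hγ0] at h1
    have := dist_triangle (γ τ) x xb
    linarith
  have hch := chain_est γ hγc (gFun Ω u) (dB Ω) (h := ε lam * ρ ^ θΓ xb)
    (M := (Kloc n p b * V) ^ (1 / p) * W) (L := CΓ * ρ) (R := (1 + CΓ) * ρ) (by positivity)
    (by positivity)
    (fun τ hτ => ⟨(hγ τ hτ).2, (dB_le_dist hxb _).trans (hdist τ hτ).le⟩) (by positivity) hvar ?_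
  · rw [hγ0, hγ1] at hch
    have h2 : |gFun Ω u x - gFun Ω u x'| ≤
        (Kloc n p b * V) ^ (1 / p) * (13 * (1 + CΓ)) * (W * ρ) := by
      refine hch.trans ?_
      have : 12 * (CΓ * ρ) + (1 + CΓ) * ρ ≤ 13 * (1 + CΓ) * ρ := by nlinarith
      calc _ ≤ (Kloc n p b * V) ^ (1 / p) * W * (13 * (1 + CΓ) * ρ) := by gcongr
        _ = _ := by ring
    have h3 := Real.rpow_le_rpow (abs_nonneg _) h2 hp0.le
    rw [Real.mul_rpow (by positivity) (by positivity), Real.mul_rpow (by positivity) (by positivity),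
      ← Real.rpow_mul (by positivity), one_div_mul_cancel hp0.ne', Real.rpow_one] at h3
    refine h3.trans ?_
    have h4 : ρ ^ alphaFun n p σ (θΓ xb) ≤ ρ ^ a :=
      Real.rpow_le_rpow_of_exponent_ge hρ (by linarith) ha
    calc _ ≤ Kloc n p b * V * (13 * (1 + CΓ)) ^ p *
          ((ε lam ^ (-(p + n)) + (1 + CΓ) ^ (p * b)) * ρ ^ a) := by
          gcongr
          refine hWρ.trans ?_
          gcongr
      _ = _ := by unfold Kkey; ring
  · intro τ hτ τ' hτ' hd
    obtain ⟨⟨hγΩ, _⟩, hγd⟩ := hγ τ hτ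
    have hd0 := dB_pos hΩo hfr hγΩ
    have hdτ := hdist τ hτ
    have hle := dB_le_dist hxb (γ τ)
    have hloc := local_est hΩo hfr hp hu hγΩ hd hσ0 hσb (by
      intro y hy
      have hyΩ : y ∈ Ω := ball_dB_subset hΩo hγΩ (ball_subset_ball (by linarith) hy)
      rw [mem_ball] at hy
      have hyx := dist_triangle y (γ τ) xb
      have hlt : dist y xb < δΓ := by nlinarith
      exact ⟨sLow_le hs0 ⟨hyΩ, hlt⟩, by linarith [dB_le_dist hxb y]⟩)
    have hsub : ball (γ τ) (dB Ω (γ τ) / 12) ⊆ ball xb (2 * (1 + CΓ) * ρ) :=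
      ball_subset_ball' (by linarith)
    have hmono : (NM Ω s p u).real (ball (γ τ) (dB Ω (γ τ) / 12)) ≤ V :=
      measureReal_mono hsub
    have h5 : |gFun Ω u (γ τ) - gFun Ω u (γ τ')| ^ p ≤
        Kloc n p b * V * dB Ω (γ τ) ^ (p * σ - n) := by
      refine hloc.trans ?_
      calc _ ≤ Kloc n p b * dB Ω (γ τ) ^ (p * σ - n) * V := by gcongr
        _ = _ := by ring
    have h6 := Real.rpow_le_rpow (by positivity) h5 (by positivity : 0 ≤ 1 / p)
    rw [← Real.rpow_mul (abs_nonneg _), mul_one_div_cancel hp0.ne', Real.rpow_one,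
      Real.mul_rpow (by positivity) (by positivity), ← Real.rpow_mul hd0.le] at h6
    have h7 : dB Ω (γ τ) ^ ((p * σ - n) * (1 / p)) =
        dB Ω (γ τ) ^ (σ - n / p - 1) * dB Ω (γ τ) := by
      rw [← Real.rpow_add_one hd0.ne']
      congr 1
      field_simp
      ring
    rw [h7] at h6
    refine h6.trans ?_
    rw [mul_assoc]
    gcongr
    exact hW _ hγd (hle.trans hdτ.le)

end keyest

section integrals

/-- The dyadic scales. -/
def rhoS (ρ0 : ℝ) (m : ℕ) : ℝ := ρ0 * (1 / 2) ^ m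

lemma rhoS_pos {ρ0 : ℝ} (h : 0 < ρ0) (m : ℕ) : 0 < rhoS ρ0 m := by unfold rhoS; positivity

lemma rhoS_le {ρ0 : ℝ} (h : 0 < ρ0) (m : ℕ) : rhoS ρ0 m ≤ ρ0 := by
  unfold rhoS
  have : ((1:ℝ) / 2) ^ m ≤ 1 := pow_le_one₀ (by norm_num) (by norm_num)
  nlinarith

lemma rhoS_succ (ρ0 : ℝ) (m : ℕ) : rhoS ρ0 (m + 1) = rhoS ρ0 m / 2 := by
  unfold rhoS; rw [pow_succ]; ring

lemma rhoS_rpow {ρ0 : ℝ} (h : 0 < ρ0) (m : ℕ) (e : ℝ) :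
    rhoS ρ0 m ^ e = ρ0 ^ e * ((1 / 2 : ℝ) ^ e) ^ m := by
  unfold rhoS
  rw [Real.mul_rpow h.le (by positivity), ← Real.rpow_natCast, ← Real.rpow_natCast,
    ← Real.rpow_mul (by norm_num), ← Real.rpow_mul (by norm_num), mul_comm e]

lemma half_rpow_lt_one {e : ℝ} (he : 0 < e) : (1 / 2 : ℝ) ^ e < 1 :=
  Real.rpow_lt_one (by norm_num) (by norm_num) he

lemma rhoS_tendsto (ρ0 : ℝ) : Tendsto (rhoS ρ0) atTop (𝓝 0) := by
  have := (tendsto_pow_atTop_nhds_zero_of_lt_one (r := (1/2:ℝ)) (by norm_num)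
    (by norm_num)).const_mul ρ0
  simp only [mul_zero] at this
  exact this

lemma geo_tsum {ρ0 e : ℝ} (h : 0 < ρ0) (he : 0 < e) :
    ∃ S : ℝ, 0 ≤ S ∧ ∑' m, ENNReal.ofReal (rhoS ρ0 m ^ e) ≤ ENNReal.ofReal S := by
  have hs : Summable fun m => rhoS ρ0 m ^ e := by
    simp_rw [rhoS_rpow h]
    exact (summable_geometric_of_lt_one (by positivity) (half_rpow_lt_one he)).mul_left _
  have h0 : ∀ m, 0 ≤ rhoS ρ0 m ^ e := fun m => Real.rpow_nonneg (rhoS_pos h m).le _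
  exact ⟨∑' m, rhoS ρ0 m ^ e, tsum_nonneg h0, (ENNReal.ofReal_tsum_of_nonneg h0 hs).ge⟩

/-- Dyadic fractional maximal-type function. -/
def Ffun (N : Measure (Euc n)) (ρ0 K q : ℝ) (x : Euc n) : ℝ≥0∞ :=
  ∑' m, ENNReal.ofReal (rhoS ρ0 m ^ q) * N (ball x (K * rhoS ρ0 m))

/-- Dyadic Riesz-type kernel. -/
def kker (ρ0 q : ℝ) (x y : Euc n) : ℝ≥0∞ :=
  ∑' m, ENNReal.ofReal (rhoS ρ0 m ^ q) * (ball x (rhoS ρ0 m)).indicator 1 y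

lemma kker_symm (ρ0 q : ℝ) (x y : Euc n) : kker ρ0 q x y = kker ρ0 q y x := by
  unfold kker
  refine tsum_congr fun m => ?_
  congr 1
  simp only [indicator, mem_ball, dist_comm x y, Pi.one_apply]

lemma measurableSet_rel (R : ℝ) : MeasurableSet {z : Euc n × Euc n | dist z.2 z.1 < R} :=
  (isOpen_lt (by fun_prop) continuous_const).measurableSet

lemma measurable_ball_measure (N : Measure (Euc n)) [SFinite N] (R : ℝ) :
    Measurable fun x => N (ball x R) :=
  measurable_measure_prodMk_left (measurableSet_rel R)

lemma measurable_Ffun (N : Measure (Euc n)) [SFinite N] (ρ0 K q : ℝ) :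
    Measurable (Ffun N ρ0 K q) :=
  Measurable.tsum fun _ => (measurable_ball_measure N _).const_mul _

lemma measurable_kker (ρ0 q : ℝ) :
    Measurable fun z : Euc n × Euc n => kker ρ0 q z.1 z.2 := by
  refine Measurable.tsum fun m => Measurable.const_mul ?_ _
  have : (fun z : Euc n × Euc n => (ball z.1 (rhoS ρ0 m)).indicator (1 : Euc n → ℝ≥0∞) z.2) =
      indicator {z : Euc n × Euc n | dist z.2 z.1 < rhoS ρ0 m} 1 := by
    ext z; simp [indicator]
  rw [this]
  exact measurable_one.indicator (measurableSet_rel _)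

variable {Γ : Set (Euc n)} {t AΓ : ℝ}

lemma kker_int (hAΓ : 1 ≤ AΓ)
    (H4' : ∀ xb ∈ Γ, ∀ ρ : ℝ, 0 < ρ → μH[t] (Γ ∩ ball xb ρ) ≤ ENNReal.ofReal (AΓ * ρ ^ t))
    {ρ0 κ : ℝ} (hρ0 : 0 < ρ0) (hκ : 0 < κ) :
    ∃ S : ℝ, 0 ≤ S ∧ ∀ x ∈ Γ, ∫⁻ y in Γ, kker ρ0 (κ - t) x y ∂μH[t] ≤ ENNReal.ofReal S := by
  obtain ⟨S, hS0, hS⟩ := geo_tsum hρ0 hκ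
  refine ⟨AΓ * S, by positivity, fun x hx => ?_⟩
  unfold kker
  rw [lintegral_tsum fun m =>
    ((measurable_one.indicator measurableSet_ball).const_mul _).aemeasurable]
  calc _ ≤ ∑' m, ENNReal.ofReal AΓ * ENNReal.ofReal (rhoS ρ0 m ^ κ) := by
        refine ENNReal.tsum_le_tsum fun m => ?_
        have hpos := rhoS_pos hρ0 m
        rw [lintegral_const_mul _ (measurable_one.indicator measurableSet_ball),
          lintegral_indicator_one measurableSet_ball, Measure.restrict_apply measurableSet_ball,
          inter_comm]
        calc _ ≤ ENNReal.ofReal (rhoS ρ0 m ^ (κ - t)) * ENNReal.ofReal (AΓ * rhoS ρ0 m ^ t) := by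
              gcongr; exact H4' x hx _ hpos
          _ = _ := by
              rw [← ENNReal.ofReal_mul (by positivity), ← ENNReal.ofReal_mul (by positivity),
                mul_left_comm, ← Real.rpow_add hpos]
              congr 3; ring
    _ ≤ _ := by
        rw [ENNReal.tsum_mul_left, ENNReal.ofReal_mul (by positivity)]
        gcongr

lemma Ffun_int (hΓfin : μH[t] Γ < ⊤) (hAΓ : 1 ≤ AΓ)
    (H4' : ∀ xb ∈ Γ, ∀ ρ : ℝ, 0 < ρ → μH[t] (Γ ∩ ball xb ρ) ≤ ENNReal.ofReal (AΓ * ρ ^ t))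
    {ρ0 κ K : ℝ} (hρ0 : 0 < ρ0) (hκ : 0 < κ) (hK : 0 < K) :
    ∃ S : ℝ, 0 ≤ S ∧ ∀ (N : Measure (Euc n)), IsFiniteMeasure N →
      ∫⁻ x in Γ, Ffun N ρ0 K (κ - t) x ∂μH[t] ≤ ENNReal.ofReal S * N univ := by
  obtain ⟨S, hS0, hS⟩ := geo_tsum hρ0 hκ
  refine ⟨AΓ * (2 * K) ^ t * S, by positivity, fun N hN => ?_⟩
  have hfin : IsFiniteMeasure ((μH[t] : Measure (Euc n)).restrict Γ) := ⟨by simpa using hΓfin⟩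
  have hball : ∀ (z : Euc n) (R : ℝ), 0 < R →
      (μH[t] : Measure (Euc n)).restrict Γ (ball z R) ≤ ENNReal.ofReal (AΓ * (2 * R) ^ t) := by
    intro z R hR
    rw [Measure.restrict_apply measurableSet_ball]
    rcases (ball z R ∩ Γ).eq_empty_or_nonempty with he | ⟨w, hw1, hw2⟩
    · rw [he]; simp
    · refine (measure_mono ?_).trans (H4' w hw2 (2 * R) (by positivity))
      rintro y ⟨hy1, hy2⟩
      refine ⟨hy2, ?_⟩
      rw [mem_ball] at *
      have := dist_triangle_right y w z
      linarith
  have hswap : ∀ R : ℝ, 0 < R → ∫⁻ x in Γ, N (ball x R) ∂μH[t] ≤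
      ENNReal.ofReal (AΓ * (2 * R) ^ t) * N univ := by
    intro R hR
    have e1 := Measure.prod_apply (μ := (μH[t] : Measure (Euc n)).restrict Γ) (ν := N)
      (measurableSet_rel R)
    have e2 := Measure.prod_apply_symm (μ := (μH[t] : Measure (Euc n)).restrict Γ) (ν := N)
      (measurableSet_rel R)
    have e3 : ∫⁻ x in Γ, N (ball x R) ∂μH[t] =
        ∫⁻ z, (μH[t] : Measure (Euc n)).restrict Γ (ball z R) ∂N := by
      refine Eq.trans ?_ (e1.symm.trans (e2.trans ?_))
      · rfl
      · refine lintegral_congr fun z => ?_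
        congr 1
        ext x
        simp [dist_comm]
    rw [e3, ← lintegral_const]
    exact lintegral_mono fun z => hball z R hR
  unfold Ffun
  rw [lintegral_tsum fun m => ((measurable_ball_measure N _).const_mul _).aemeasurable]
  calc _ ≤ ∑' m, ENNReal.ofReal (AΓ * (2 * K) ^ t) * N univ *
          ENNReal.ofReal (rhoS ρ0 m ^ κ) := by
        refine ENNReal.tsum_le_tsum fun m => ?_
        have hpos := rhoS_pos hρ0 m
        rw [lintegral_const_mul _ (measurable_ball_measure N _)]
        calc _ ≤ ENNReal.ofReal (rhoS ρ0 m ^ (κ - t)) *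
              (ENNReal.ofReal (AΓ * (2 * (K * rhoS ρ0 m)) ^ t) * N univ) := by
              gcongr; exact hswap _ (by positivity)
          _ = _ := by
              rw [← mul_assoc, mul_right_comm _ (N univ), ← ENNReal.ofReal_mul (by positivity),
                ← ENNReal.ofReal_mul (by positivity), ← mul_assoc 2 K,
                Real.mul_rpow (by positivity) hpos.le]
              congr 2
              rw [Real.rpow_sub hpos]
              have : rhoS ρ0 m ^ t ≠ 0 := by positivity
              field_simp
    _ ≤ _ := by
        rw [ENNReal.tsum_mul_left, ENNReal.ofReal_mul (q := S) (by positivity), mul_right_comm]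
        gcongr

lemma double_int {H : Measure (Euc n)} [IsFiniteMeasure H] {S : ℝ}
    {k : Euc n → Euc n → ℝ≥0∞} (hkmeas : Measurable fun z : Euc n × Euc n => k z.1 z.2)
    (hsymm : ∀ x y, k x y = k y x)
    (hk : ∀ᵐ x ∂H, ∫⁻ y, k x y ∂H ≤ ENNReal.ofReal S)
    {G : Euc n → ℝ≥0∞} (hG : Measurable G) :
    ∫⁻ x, ∫⁻ y, (k x y + 1) * (G x + G y) ∂H ∂H ≤
      2 * ((ENNReal.ofReal S + H univ) * ∫⁻ x, G x ∂H) := by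
  have hkm : Measurable fun z : Euc n × Euc n => k z.1 z.2 + 1 :=
    hkmeas.add_const _
  have hkx : ∀ x, Measurable fun y => k x y + 1 := fun x =>
    hkm.comp measurable_prodMk_left
  have hk' : ∀ᵐ x ∂H, ∫⁻ y, (k x y + 1) ∂H ≤ ENNReal.ofReal S + H univ := by
    filter_upwards [hk] with x hx
    rw [lintegral_add_right _ measurable_const]
    simp only [lintegral_const, one_mul]
    gcongr
  have hA : ∫⁻ x, ∫⁻ y, (k x y + 1) * G x ∂H ∂H ≤
      (ENNReal.ofReal S + H univ) * ∫⁻ x, G x ∂H := by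
    rw [← lintegral_const_mul _ hG]
    refine lintegral_mono_ae ?_
    filter_upwards [hk'] with x hx
    rw [lintegral_mul_const _ (hkx x)]
    gcongr
  have hB : ∫⁻ x, ∫⁻ y, (k x y + 1) * G y ∂H ∂H =
      ∫⁻ x, ∫⁻ y, (k x y + 1) * G x ∂H ∂H := by
    rw [lintegral_lintegral_swap]
    · refine lintegral_congr fun x => lintegral_congr fun y => ?_
      rw [hsymm]
    · exact (hkm.mul (hG.comp measurable_snd)).aemeasurable
  have hmx : Measurable fun x => ∫⁻ y, (k x y + 1) * G x ∂H :=
    (hkm.mul (hG.comp measurable_fst)).lintegral_prod_right'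
  calc _ = ∫⁻ x, (∫⁻ y, (k x y + 1) * G x ∂H + ∫⁻ y, (k x y + 1) * G y ∂H) ∂H := by
        refine lintegral_congr fun x => ?_
        rw [← lintegral_add_left ((hkx x).mul_const _)]
        simp_rw [mul_add]
    _ = _ := lintegral_add_left hmx _
    _ ≤ _ := by rw [hB, two_mul]; gcongr

end integrals

section pointwise

lemma g_bound {Ω : Set (Euc n)} (hΩo : IsOpen Ω) {u : Euc n → ℝ} (hu : IntegrableOn u Ω)
    {x : Euc n} (hx : x ∈ Ω) {d0 : ℝ} (hd0 : 0 < d0) (hd : d0 ≤ dB Ω x) :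
    |gFun Ω u x| ≤ ((d0 / 6) ^ n * volume.real (ball (0 : Euc n) 1))⁻¹ * ∫ z in Ω, |u z| := by
  have hω := omega_pos n
  have hdx : 0 < dB Ω x := by linarith
  have hvol : volume.real (ball x (dB Ω x / 6)) =
      (dB Ω x / 6) ^ n * volume.real (ball (0 : Euc n) 1) := by
    rw [Measure.real, Measure.addHaar_ball_of_pos _ _ (by positivity), ENNReal.toReal_mul,
      ENNReal.toReal_ofReal (by positivity), finrank_euclideanSpace_fin]; rfl
  unfold gFun PhiB
  rw [setAverage_eq, hvol, smul_eq_mul, abs_mul, abs_of_pos (by positivity)]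
  have hsub : ball x (dB Ω x / 6) ⊆ Ω :=
    (ball_subset_ball (by linarith)).trans (ball_dB_subset hΩo hx)
  have e2 : |∫ z in ball x (dB Ω x / 6), u z| ≤ ∫ z in Ω, |u z| :=
    (abs_integral_le_integral_abs).trans
      (setIntegral_mono_set hu.abs (ae_of_all _ fun _ => abs_nonneg _) hsub.eventuallyLE)
  gcongr

lemma Ffun_term {N : Measure (Euc n)} {ρ0 K q : ℝ} (hρ0 : 0 < ρ0) {x : Euc n}
    (h : Ffun N ρ0 K q x ≠ ⊤) (m : ℕ) :
    rhoS ρ0 m ^ q * N.real (ball x (K * rhoS ρ0 m)) ≤ (Ffun N ρ0 K q x).toReal := by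
  have h1 : ENNReal.ofReal (rhoS ρ0 m ^ q) * N (ball x (K * rhoS ρ0 m)) ≤ Ffun N ρ0 K q x :=
    ENNReal.le_tsum m
  have h2 := ENNReal.toReal_mono h h1
  rwa [ENNReal.toReal_mul, ENNReal.toReal_ofReal
    (Real.rpow_nonneg (rhoS_pos hρ0 m).le _)] at h2

lemma pointwise_est (n : ℕ) (p CΓ δΓ : ℝ)
    (hp : 1 ≤ p) (hCΓ : 1 ≤ CΓ) (hδΓ0 : 0 < δΓ) (hδΓ1 : δΓ < 1)
    (Ω : Set (Euc n)) (hΩo : IsOpen Ω)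
    (Γ : Set (Euc n)) (hΓfr : Γ ⊆ frontier Ω)
    (θΓ : Euc n → ℝ) (hθ1 : ∀ xb, 1 ≤ θΓ xb) (hθb : ∃ b : ℝ, ∀ xb, θΓ xb ≤ b)
    (s : Euc n → ℝ) (hs0 : ∀ x, 0 ≤ s x) (hsb : ∃ b : ℝ, ∀ x, s x ≤ b)
    (lam₀ η₀ : ℝ) (hη₀ : 0 < η₀) (hη₀1 : η₀ < 1)
    (H1 : ∀ xb ∈ Γ, IsCorkscrew Ω (Qreg Ω lam₀ (θΓ xb) xb) xb η₀ (θΓ xb) δΓ)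
    (ε : ℝ → ℝ)
    (H2 : ∀ xb ∈ Γ, ConnectedTo Ω (Ω ∩ ball xb δΓ) xb CΓ (θΓ xb) (δΓ / (3 * CΓ)) ε)
    (αΓ : ℝ) (hα : ∀ xb ∈ Γ, αΓ ≤ alphaLow Ω s p θΓ xb δΓ)
    (β : ℝ) (hβ0 : 0 < β) :
    ∃ A : ℝ, 0 ≤ A ∧ ∀ u : Euc n → ℝ, MemN Ω s p u → ∀ T : Euc n → ℝ,
      ∀ F : Euc n → ℝ≥0∞,
      F = Ffun (NM Ω s p u) (δΓ / (3 * CΓ)) (2 * (1 + CΓ)) (αΓ - β * p) →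
      (∀ x ∈ Γ, Tendsto (gFun Ω u) (𝓝[Qreg Ω lam₀ (θΓ x) x] x) (𝓝 (T x)) → F x ≠ ⊤ →
        |T x| ≤ A * ((∫ z in Ω, |u z|) + (F x).toReal ^ (1 / p))) ∧
      (∀ x ∈ Γ, ∀ y ∈ Γ, Tendsto (gFun Ω u) (𝓝[Qreg Ω lam₀ (θΓ x) x] x) (𝓝 (T x)) →
        Tendsto (gFun Ω u) (𝓝[Qreg Ω lam₀ (θΓ y) y] y) (𝓝 (T y)) → F x ≠ ⊤ → F y ≠ ⊤ →
        ∀ m : ℕ, dist x y < rhoS (δΓ / (3 * CΓ)) (m + 1) →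
        |T x - T y| ≤ A * rhoS (δΓ / (3 * CΓ)) m ^ β *
          ((F x).toReal ^ (1 / p) + (F y).toReal ^ (1 / p))) := by
  have hp0 : 0 < p := by linarith
  obtain ⟨bθ, hbθ⟩ := hθb
  obtain ⟨b, hb⟩ := hsb
  set ρ0 := δΓ / (3 * CΓ) with hρ0_def
  have hρ0 : 0 < ρ0 := by positivity
  have hρ0δ : ρ0 ≤ δΓ := by
    rw [hρ0_def, div_le_iff₀ (by positivity)]; nlinarith
  set lam := η₀ / 2 with hlam
  have hlam0 : 0 < lam := by positivity
  have hlam1 : lam < 1 := by linarith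
  set A1 := |Kkey n p b CΓ (ε lam)| ^ (1 / p) with hA1
  have hA10 : 0 ≤ A1 := by positivity
  set r := (1 / 2 : ℝ) ^ β with hr
  have hr1 : r < 1 := half_rpow_lt_one hβ0
  set κ := 1 / (1 - r) with hκ
  have hκ0 : 0 < κ := by have : 0 < 1 - r := by linarith
                         positivity
  set d0 := (η₀ * ρ0) ^ bθ with hd0
  have hd00 : 0 < d0 := by positivity
  set D0 := ((d0 / 6) ^ n * volume.real (ball (0 : Euc n) 1))⁻¹ with hD0
  have hω := omega_pos n
  have hD00 : 0 < D0 := by positivity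
  refine ⟨D0 + A1 * (κ + 1), by positivity, fun u hu T F hF => ?_⟩
  have hpos := rhoS_pos hρ0
  have hle := rhoS_le hρ0
  -- corkscrew points
  have hc : ∀ x ∈ Γ, ∀ m : ℕ, ∃ c, c ∈ Qreg Ω lam₀ (θΓ x) x ∧ dist x c < rhoS ρ0 m ∧
      (η₀ * rhoS ρ0 m) ^ θΓ x < dB Ω c := by
    intro x hx m
    obtain ⟨c, hc1, _, hc2, hc3⟩ := H1 x hx (rhoS ρ0 m) (hpos m) ((hle m).trans hρ0δ)
    exact ⟨c, hc1, hc2, hc3⟩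
  have hKE : ∀ x ∈ Γ, F x ≠ ⊤ → ∀ (m : ℕ) (z z' : Euc n), z ∈ Ω → z' ∈ Ω →
      dist z x < rhoS ρ0 m → dist z' x < rhoS ρ0 m →
      (lam * rhoS ρ0 m) ^ θΓ x ≤ dB Ω z → (lam * rhoS ρ0 m) ^ θΓ x ≤ dB Ω z' →
      |gFun Ω u z - gFun Ω u z'| ≤ A1 * (F x).toReal ^ (1 / p) * rhoS ρ0 m ^ β := by
    intro x hx hFx m z z' hz hz' hd hd' hz1 hz2
    have hk := key_est hΩo hs0 hb hp hu hCΓ hδΓ0 hδΓ1 (hΓfr hx) (hθ1 x) (H2 x hx) (hα x hx)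
      hlam0 hlam1 (hpos m) (hle m) hz hz' hd hd' hz1 hz2
    have ht := Ffun_term hρ0 (hF ▸ hFx) m
    rw [← hF] at ht
    set φ := (F x).toReal with hφ
    have hφ0 : 0 ≤ φ := ENNReal.toReal_nonneg
    set V := (NM Ω s p u).real (ball x (2 * (1 + CΓ) * rhoS ρ0 m))
    have hV0 : 0 ≤ V := measureReal_nonneg
    have hposm := hpos m
    have h1 : |gFun Ω u z - gFun Ω u z'| ^ p ≤
        |Kkey n p b CΓ (ε lam)| * φ * (rhoS ρ0 m ^ β) ^ p := by
      calc _ ≤ _ := hk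
        _ ≤ |Kkey n p b CΓ (ε lam)| * rhoS ρ0 m ^ αΓ * V := by
            gcongr; exact le_abs_self _
        _ = |Kkey n p b CΓ (ε lam)| * (rhoS ρ0 m ^ (αΓ - β * p) * V) * (rhoS ρ0 m ^ β) ^ p := by
            rw [← Real.rpow_mul hposm.le, Real.rpow_sub hposm]
            have : rhoS ρ0 m ^ (β * p) ≠ 0 := by positivity
            field_simp
        _ ≤ _ := by gcongr
    have h6 := Real.rpow_le_rpow (by positivity) h1 (by positivity : 0 ≤ 1 / p)
    rwa [← Real.rpow_mul (abs_nonneg _), mul_one_div_cancel hp0.ne', Real.rpow_one,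
      Real.mul_rpow (by positivity) (by positivity), Real.mul_rpow (by positivity) (by positivity),
      ← Real.rpow_mul (by positivity), mul_one_div_cancel hp0.ne', Real.rpow_one] at h6
  have hhalf : ∀ m, lam * rhoS ρ0 m = η₀ * rhoS ρ0 (m + 1) := by
    intro m; rw [rhoS_succ, hlam]; ring
  have hηρ : ∀ m, η₀ * rhoS ρ0 m ≤ 1 := by
    intro m
    have := hle m
    have := hpos m
    nlinarith
  have hηρ0 : ∀ m, 0 < η₀ * rhoS ρ0 m := fun m => mul_pos hη₀ (hpos m)
  have hmono : ∀ m, rhoS ρ0 (m + 1) ≤ rhoS ρ0 m := by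
    intro m; rw [rhoS_succ]; linarith [hpos m]
  have hthalf : ∀ x m, (lam * rhoS ρ0 m) ^ θΓ x ≤ (η₀ * rhoS ρ0 m) ^ θΓ x := by
    intro x m
    rw [hhalf]
    refine Real.rpow_le_rpow (hηρ0 _).le ?_ (by linarith [hθ1 x])
    exact mul_le_mul_of_nonneg_left (hmono m) hη₀.le
  -- trace versus corkscrew points
  have hTR : ∀ x ∈ Γ, Tendsto (gFun Ω u) (𝓝[Qreg Ω lam₀ (θΓ x) x] x) (𝓝 (T x)) → F x ≠ ⊤ →
      ∀ c : ℕ → Euc n, (∀ m, c m ∈ Qreg Ω lam₀ (θΓ x) x ∧ dist x (c m) < rhoS ρ0 m ∧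
      (η₀ * rhoS ρ0 m) ^ θΓ x < dB Ω (c m)) → ∀ m,
      |gFun Ω u (c m) - T x| ≤ κ * A1 * (F x).toReal ^ (1 / p) * rhoS ρ0 m ^ β := by
    intro x hx hT hFx c hc m
    have hct : Tendsto c atTop (𝓝[Qreg Ω lam₀ (θΓ x) x] x) := by
      refine tendsto_nhdsWithin_iff.2 ⟨?_, Eventually.of_forall fun m => (hc m).1⟩
      rw [tendsto_iff_dist_tendsto_zero]
      refine squeeze_zero (fun _ => dist_nonneg) (fun m => ?_) (rhoS_tendsto ρ0)
      rw [dist_comm]; exact (hc m).2.1.le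
    have hg := hT.comp hct
    have hgeo := dist_le_of_le_geometric_of_tendsto r (A1 * (F x).toReal ^ (1 / p) * ρ0 ^ β) hr1
      (f := fun m => gFun Ω u (c m)) (fun m => ?_) hg m
    · rw [Real.dist_eq] at hgeo
      refine hgeo.trans (le_of_eq ?_)
      rw [rhoS_rpow hρ0, hκ]
      ring
    · rw [Real.dist_eq]
      have := hKE x hx hFx m (c m) (c (m + 1)) (hc m).1.1 (hc (m + 1)).1.1
        (by rw [dist_comm]; exact (hc m).2.1)
        (by rw [dist_comm]; exact (hc (m + 1)).2.1.trans_le (hmono m))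
        ((hthalf x m).trans (hc m).2.2.le)
        (by rw [hhalf]; exact (hc (m + 1)).2.2.le)
      refine this.trans (le_of_eq ?_)
      rw [rhoS_rpow hρ0]; ring
  refine ⟨?_, ?_⟩
  · intro x hx hT hFx
    choose c hc' using hc x hx
    have h1 := hTR x hx hT hFx c hc' 0
    have h2 := g_bound hΩo hu.1 (hc' 0).1.1 hd00 (by
      refine le_trans ?_ (hc' 0).2.2.le
      have h0 : rhoS ρ0 0 = ρ0 := by simp [rhoS]
      have q := Real.rpow_le_rpow_of_exponent_ge (hηρ0 0) (hηρ 0) (hbθ x)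
      rw [h0] at q ⊢
      exact q)
    have h3 : rhoS ρ0 0 ^ β ≤ 1 :=
      Real.rpow_le_one (hpos 0).le ((hle 0).trans (by linarith)) hβ0.le
    set U := ∫ z in Ω, |u z| with hU
    have hU0 : 0 ≤ U := integral_nonneg fun _ => abs_nonneg _
    set φ := (F x).toReal ^ (1 / p) with hφ
    have hφ0 : 0 ≤ φ := by positivity
    have h4 : κ * A1 * φ * rhoS ρ0 0 ^ β ≤ κ * A1 * φ * 1 := by gcongr
    have h5 : |T x| ≤ |gFun Ω u (c 0)| + |gFun Ω u (c 0) - T x| := by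
      have := abs_sub_abs_le_abs_sub (T x) (gFun Ω u (c 0))
      rw [abs_sub_comm (T x)] at this
      linarith
    have h6 : 0 ≤ D0 * φ := by positivity
    have h7 : 0 ≤ A1 * (κ + 1) * U := by positivity
    have h8 : 0 ≤ A1 * φ := by positivity
    nlinarith
  · intro x hx y hy hTx hTy hFx hFy m hxy
    choose c hc1 using hc x hx
    choose e he1 using hc y hy
    have h1 := hTR x hx hTx hFx c hc1 (m + 1)
    have h2 := hTR y hy hTy hFy e he1 (m + 1)
    set φ := (F x).toReal ^ (1 / p) with hφ
    set ψ := (F y).toReal ^ (1 / p) with hψ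
    have hφ0 : 0 ≤ φ := by positivity
    have hψ0 : 0 ≤ ψ := by positivity
    have hposm := hpos m
    have hm2 : rhoS ρ0 m = 2 * rhoS ρ0 (m + 1) := by rw [rhoS_succ]; ring
    have h3 : |gFun Ω u (c (m + 1)) - gFun Ω u (e (m + 1))| ≤
        A1 * (φ + ψ) * rhoS ρ0 m ^ β := by
      have hcx := (hc1 (m + 1)).2.1
      have hey := (he1 (m + 1)).2.1
      rw [dist_comm] at hcx hey
      have t1 := dist_triangle (e (m + 1)) y x
      have t2 := dist_triangle (c (m + 1)) x y
      rw [dist_comm y x] at t1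
      rcases le_total (θΓ y) (θΓ x) with hθ | hθ
      · have := hKE x hx hFx m _ _ (hc1 (m + 1)).1.1 (he1 (m + 1)).1.1 (by linarith [hmono m])
          (by linarith) (by rw [hhalf]; exact (hc1 (m + 1)).2.2.le)
          (by
            rw [hhalf]
            exact (Real.rpow_le_rpow_of_exponent_ge (hηρ0 _) (hηρ _) hθ).trans
              (he1 (m + 1)).2.2.le)
        refine this.trans ?_
        gcongr
        linarith
      · have := hKE y hy hFy m _ _ (hc1 (m + 1)).1.1 (he1 (m + 1)).1.1 (by linarith)
          (by linarith [hmono m])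
          (by
            rw [hhalf]
            exact (Real.rpow_le_rpow_of_exponent_ge (hηρ0 _) (hηρ _) hθ).trans
              (hc1 (m + 1)).2.2.le)
          (by rw [hhalf]; exact (he1 (m + 1)).2.2.le)
        refine this.trans ?_
        gcongr
        linarith
    have h4 : rhoS ρ0 (m + 1) ^ β ≤ rhoS ρ0 m ^ β :=
      Real.rpow_le_rpow (hpos _).le (hmono m) hβ0.le
    have h5 : κ * A1 * φ * rhoS ρ0 (m + 1) ^ β ≤ κ * A1 * φ * rhoS ρ0 m ^ β := by gcongr
    have h6 : κ * A1 * ψ * rhoS ρ0 (m + 1) ^ β ≤ κ * A1 * ψ * rhoS ρ0 m ^ β := by gcongr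
    have h7 : |T x - T y| ≤ |gFun Ω u (c (m + 1)) - T x| +
        |gFun Ω u (c (m + 1)) - gFun Ω u (e (m + 1))| + |gFun Ω u (e (m + 1)) - T y| := by
      have i1 := abs_sub_le (T x) (gFun Ω u (c (m + 1))) (T y)
      have i2 := abs_sub_le (gFun Ω u (c (m + 1))) (gFun Ω u (e (m + 1))) (T y)
      rw [abs_sub_comm (T x) (gFun Ω u (c (m + 1)))] at i1
      linarith
    have h8 : 0 ≤ D0 * rhoS ρ0 m ^ β * (φ + ψ) := by positivity
    calc _ ≤ _ := h7
      _ ≤ κ * A1 * φ * rhoS ρ0 m ^ β + A1 * (φ + ψ) * rhoS ρ0 m ^ β +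
          κ * A1 * ψ * rhoS ρ0 m ^ β := by linarith
      _ ≤ _ := by linarith

end pointwise

section final

lemma add_rpow_le_two {a b p : ℝ} (ha : 0 ≤ a) (hb : 0 ≤ b) (hp : 0 ≤ p) :
    (a + b) ^ p ≤ 2 ^ p * (a ^ p + b ^ p) := by
  have ha' : 0 ≤ a ^ p := by positivity
  have hb' : 0 ≤ b ^ p := by positivity
  have h2 : (0:ℝ) ≤ 2 ^ p := by positivity
  rcases le_total a b with h | h
  · calc (a + b) ^ p ≤ (2 * b) ^ p := Real.rpow_le_rpow (by positivity) (by linarith) hp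
      _ = 2 ^ p * b ^ p := Real.mul_rpow (by norm_num) hb
      _ ≤ _ := by nlinarith
  · calc (a + b) ^ p ≤ (2 * a) ^ p := Real.rpow_le_rpow (by positivity) (by linarith) hp
      _ = 2 ^ p * a ^ p := Real.mul_rpow (by norm_num) ha
      _ ≤ _ := by nlinarith

lemma exists_scale {ρ0 r : ℝ} (hr : 0 < r) (h : r < rhoS ρ0 1) :
    ∃ m, r < rhoS ρ0 (m + 1) ∧ rhoS ρ0 (m + 2) ≤ r := by
  classical
  have hex : ∃ m, rhoS ρ0 (m + 2) ≤ r := by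
    have h1 := (rhoS_tendsto ρ0).comp (tendsto_add_atTop_nat 2)
    exact ((h1.eventually (gt_mem_nhds hr)).exists).imp fun m hm => le_of_lt hm
  refine ⟨Nat.find hex, ?_, Nat.find_spec hex⟩
  rcases hm : Nat.find hex with _ | k
  · exact h
  · have := Nat.find_min hex (m := k) (by omega)
    push Not at this
    exact this

/-- Real pointwise bound turned into the extended-real integrand bounds. -/
lemma integrand_est {p t β β' ρ0 A U : ℝ} (hp : 1 ≤ p) (hρ0 : 0 < ρ0)
    (ht : 0 ≤ t) (hβ : 0 < β) (hA : 0 ≤ A) (hU : 0 ≤ U) {C : ℝ}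
    (hC : C = 1 + (2 * A) ^ p + (2 * A) ^ p * 4 ^ (t + β * p) +
      2 ^ p * (2 * A) ^ p / (rhoS ρ0 1) ^ (t + β * p))
    {F : Euc n → ℝ≥0∞} {T : Euc n → ℝ} {x y : Euc n}
    (hx : F x ≠ ⊤ → |T x| ≤ A * (U + (F x).toReal ^ (1 / p)))
    (hy : F y ≠ ⊤ → |T y| ≤ A * (U + (F y).toReal ^ (1 / p)))
    (hxy : F x ≠ ⊤ → F y ≠ ⊤ → ∀ m : ℕ, dist x y < rhoS ρ0 (m + 1) →
        |T x - T y| ≤ A * rhoS ρ0 m ^ β' *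
          ((F x).toReal ^ (1 / p) + (F y).toReal ^ (1 / p))) :
    ENNReal.ofReal (|T x| ^ p) ≤ ENNReal.ofReal C * (F x + ENNReal.ofReal (U ^ p)) ∧
    ENNReal.ofReal (|T y - T x| ^ p / dist y x ^ (t + β * p)) ≤
      ENNReal.ofReal C * ((kker ρ0 ((β' - β) * p - t) x y + 1) *
        ((F x + ENNReal.ofReal (U ^ p)) + (F y + ENNReal.ofReal (U ^ p)))) := by
  have hp0 : 0 < p := by linarith
  have hρ1 := rhoS_pos hρ0 1
  have hC1 : 1 ≤ C := by
    rw [hC]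
    have h1 : 0 ≤ (2 * A) ^ p := by positivity
    have h2 : 0 ≤ (2 * A) ^ p * 4 ^ (t + β * p) := by positivity
    have h3 : 0 ≤ 2 ^ p * (2 * A) ^ p / (rhoS ρ0 1) ^ (t + β * p) := by positivity
    linarith
  have hCne : ENNReal.ofReal C ≠ 0 := by
    rw [Ne, ENNReal.ofReal_eq_zero]; linarith
  have single : ∀ z : Euc n, (F z ≠ ⊤ → |T z| ≤ A * (U + (F z).toReal ^ (1 / p))) → F z ≠ ⊤ →
      |T z| ^ p ≤ (2 * A) ^ p * ((F z).toReal + U ^ p) := by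
    intro z hz hFz
    have hφ : 0 ≤ (F z).toReal := ENNReal.toReal_nonneg
    calc |T z| ^ p ≤ (A * (U + (F z).toReal ^ (1 / p))) ^ p :=
          Real.rpow_le_rpow (abs_nonneg _) (hz hFz) hp0.le
      _ = A ^ p * (U + (F z).toReal ^ (1 / p)) ^ p := Real.mul_rpow hA (by positivity)
      _ ≤ A ^ p * (2 ^ p * (U ^ p + ((F z).toReal ^ (1 / p)) ^ p)) := by
          gcongr
          exact add_rpow_le_two hU (by positivity) hp0.le
      _ = _ := by
          rw [← Real.rpow_mul hφ, one_div_mul_cancel hp0.ne', Real.rpow_one,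
            Real.mul_rpow (by norm_num) hA]
          ring
  constructor
  · by_cases hFx : F x = ⊤
    · rw [hFx, top_add, ENNReal.mul_top hCne]; exact le_top
    · have e : F x + ENNReal.ofReal (U ^ p) = ENNReal.ofReal ((F x).toReal + U ^ p) := by
        rw [ENNReal.ofReal_add ENNReal.toReal_nonneg (by positivity), ENNReal.ofReal_toReal hFx]
      rw [e, ← ENNReal.ofReal_mul (by linarith)]
      refine ENNReal.ofReal_le_ofReal ((single x hx hFx).trans ?_)
      have : 0 ≤ (F x).toReal + U ^ p := add_nonneg ENNReal.toReal_nonneg (by positivity)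
      gcongr
      rw [hC]
      have h2 : 0 ≤ (2 * A) ^ p * 4 ^ (t + β * p) := by positivity
      have h3 : 0 ≤ 2 ^ p * (2 * A) ^ p / (rhoS ρ0 1) ^ (t + β * p) := by positivity
      linarith
  · set k := kker ρ0 ((β' - β) * p - t) x y with hk
    have hk1 : k + 1 ≠ 0 := by simp
    by_cases hFx : F x = ⊤
    · rw [hFx, top_add, top_add, ENNReal.mul_top hk1, ENNReal.mul_top hCne]; exact le_top
    by_cases hFy : F y = ⊤
    · rw [hFy, top_add, add_top, ENNReal.mul_top hk1, ENNReal.mul_top hCne]; exact le_top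
    have hs1 := single x hx hFx
    have hs2 := single y hy hFy
    have hm := hxy hFx hFy
    set φ := (F x).toReal with hφ
    set ψ := (F y).toReal with hψ
    have hφ0 : 0 ≤ φ := ENNReal.toReal_nonneg
    have hψ0 : 0 ≤ ψ := ENNReal.toReal_nonneg
    have hUp : 0 ≤ U ^ p := by positivity
    have e : (F x + ENNReal.ofReal (U ^ p)) + (F y + ENNReal.ofReal (U ^ p)) =
        ENNReal.ofReal ((φ + U ^ p) + (ψ + U ^ p)) := by
      rw [ENNReal.ofReal_add (by positivity) (by positivity), ENNReal.ofReal_add hφ0 hUp,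
        ENNReal.ofReal_add hψ0 hUp, ENNReal.ofReal_toReal hFx, ENNReal.ofReal_toReal hFy]
    rw [e]
    set Z := (φ + U ^ p) + (ψ + U ^ p) with hZ
    have hZ0 : 0 ≤ Z := by positivity
    have hexp : t + β * p ≠ 0 := by positivity
    have hexp0 : 0 ≤ t + β * p := by positivity
    rcases eq_or_ne x y with rfl | hne
    · simp [Real.zero_rpow hp0.ne']
    have hr : 0 < dist y x := dist_pos.2 hne.symm
    by_cases hc : dist y x < rhoS ρ0 1
    · obtain ⟨m, hm1, hm2⟩ := exists_scale hr hc
      have hposm := rhoS_pos hρ0 m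
      have hd := hm m (by rwa [dist_comm])
      rw [abs_sub_comm] at hd
      have hkm : ENNReal.ofReal (rhoS ρ0 m ^ ((β' - β) * p - t)) ≤ k + 1 := by
        refine le_trans ?_ le_self_add
        refine le_trans ?_ (ENNReal.le_tsum m)
        have hmem : y ∈ ball x (rhoS ρ0 m) := by
          rw [mem_ball]; rw [rhoS_succ] at hm1; linarith
        simp [indicator_of_mem hmem]
      have hv : |T y - T x| ^ p / dist y x ^ (t + β * p) ≤
          C * (rhoS ρ0 m ^ ((β' - β) * p - t) * Z) := by
        have hq : rhoS ρ0 (m + 2) = rhoS ρ0 m / 4 := by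
          rw [rhoS_succ, rhoS_succ]; ring
        have h1 : |T y - T x| ^ p ≤ (2 * A) ^ p * rhoS ρ0 m ^ (β' * p) * (φ + ψ) := by
          calc |T y - T x| ^ p ≤ (A * rhoS ρ0 m ^ β' * (φ ^ (1 / p) + ψ ^ (1 / p))) ^ p :=
                Real.rpow_le_rpow (abs_nonneg _) hd hp0.le
            _ = A ^ p * rhoS ρ0 m ^ (β' * p) * (φ ^ (1 / p) + ψ ^ (1 / p)) ^ p := by
                rw [Real.mul_rpow (by positivity) (by positivity),
                  Real.mul_rpow hA (by positivity), ← Real.rpow_mul hposm.le]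
            _ ≤ A ^ p * rhoS ρ0 m ^ (β' * p) *
                (2 ^ p * ((φ ^ (1 / p)) ^ p + (ψ ^ (1 / p)) ^ p)) := by
                gcongr
                exact add_rpow_le_two (by positivity) (by positivity) hp0.le
            _ = _ := by
                rw [← Real.rpow_mul hφ0, ← Real.rpow_mul hψ0, one_div_mul_cancel hp0.ne',
                  Real.rpow_one, Real.rpow_one, Real.mul_rpow (by norm_num) hA]
                ring
        calc _ ≤ ((2 * A) ^ p * rhoS ρ0 m ^ (β' * p) * (φ + ψ)) /
              (rhoS ρ0 m / 4) ^ (t + β * p) := by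
              rw [hq] at hm2
              gcongr
          _ = (2 * A) ^ p * 4 ^ (t + β * p) * (rhoS ρ0 m ^ ((β' - β) * p - t) * (φ + ψ)) := by
              have : (β' - β) * p - t = β' * p - (t + β * p) := by ring
              rw [this, Real.rpow_sub hposm, Real.div_rpow hposm.le (by norm_num)]
              have : rhoS ρ0 m ^ (t + β * p) ≠ 0 := by positivity
              field_simp
          _ ≤ _ := by
              have h1 : 0 ≤ (2 * A) ^ p := by positivity
              have h3 : 0 ≤ 2 ^ p * (2 * A) ^ p / (rhoS ρ0 1) ^ (t + β * p) := by positivity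
              gcongr
              · rw [hC]; linarith
              · rw [hZ]; linarith
      refine (ENNReal.ofReal_le_ofReal hv).trans ?_
      rw [ENNReal.ofReal_mul (by linarith), ENNReal.ofReal_mul (by positivity)]
      gcongr
    · push Not at hc
      have hv : |T y - T x| ^ p / dist y x ^ (t + β * p) ≤ C * (1 * Z) := by
        calc _ ≤ (2 ^ p * ((2 * A) ^ p * Z)) / rhoS ρ0 1 ^ (t + β * p) := by
              gcongr
              calc |T y - T x| ^ p ≤ (|T y| + |T x|) ^ p :=
                    Real.rpow_le_rpow (abs_nonneg _) (abs_sub _ _) hp0.le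
                _ ≤ 2 ^ p * (|T y| ^ p + |T x| ^ p) :=
                    add_rpow_le_two (abs_nonneg _) (abs_nonneg _) hp0.le
                _ ≤ _ := by
                    gcongr
                    rw [hZ]; linarith
          _ = 2 ^ p * (2 * A) ^ p / rhoS ρ0 1 ^ (t + β * p) * (1 * Z) := by ring
          _ ≤ _ := by
              have h1 : 0 ≤ (2 * A) ^ p := by positivity
              have h2 : 0 ≤ (2 * A) ^ p * 4 ^ (t + β * p) := by positivity
              gcongr
              rw [hC]; linarith
      refine (ENNReal.ofReal_le_ofReal hv).trans ?_
      rw [ENNReal.ofReal_mul (by linarith), ENNReal.ofReal_mul (by positivity), ENNReal.ofReal_one]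
      gcongr
      exact le_add_self

end final

lemma root_est {p C V U : ℝ} (hp : 1 ≤ p) (hC : 0 ≤ C) (hV : 0 ≤ V) (hU : 0 ≤ U) {I : ℝ≥0∞}
    (hI : I ≤ ENNReal.ofReal C * (ENNReal.ofReal V + ENNReal.ofReal (U ^ p))) :
    I ^ (1 / p : ℝ) ≤ ENNReal.ofReal (C ^ (1 / p) * (U + V ^ (1 / p))) := by
  have hp0 : 0 < p := by linarith
  have h1 : 0 ≤ 1 / p := by positivity
  calc I ^ (1 / p : ℝ)
      ≤ (ENNReal.ofReal C * (ENNReal.ofReal V + ENNReal.ofReal (U ^ p))) ^ (1 / p : ℝ) :=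
        ENNReal.rpow_le_rpow hI h1
    _ = ENNReal.ofReal C ^ (1 / p : ℝ) *
        (ENNReal.ofReal V + ENNReal.ofReal (U ^ p)) ^ (1 / p : ℝ) :=
        ENNReal.mul_rpow_of_nonneg _ _ h1
    _ ≤ ENNReal.ofReal C ^ (1 / p : ℝ) *
        (ENNReal.ofReal V ^ (1 / p : ℝ) + ENNReal.ofReal (U ^ p) ^ (1 / p : ℝ)) := by
        gcongr
        exact ENNReal.rpow_add_le_add_rpow _ _ h1 (by rw [div_le_one hp0]; exact hp)
    _ = _ := by
        rw [ENNReal.ofReal_rpow_of_nonneg hC h1, ENNReal.ofReal_rpow_of_nonneg hV h1,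
          ENNReal.ofReal_rpow_of_nonneg (by positivity) h1, ← Real.rpow_mul hU,
          mul_one_div_cancel hp0.ne', Real.rpow_one, ← ENNReal.ofReal_add (by positivity) hU,
          ← ENNReal.ofReal_mul (by positivity), add_comm U]


/-- continuity of the trace into `W^{β,p}(Γ)`. Under (H1), (H2), (H3″) and
(H4′), with `H^t(Γ) < ∞` and `0 < β < β₀ = (α̲_Γ + t)/p`, the trace satisfies
`‖Tu‖_{Lᵖ(Γ)} + |Tu|_{W^{β,p}(Γ)} ≤ C (‖u‖_{L¹(Ω)} + ν(Ω;u)^{1/p})` with `C` independent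
of `u`. -/
theorem statement17 (n : ℕ) (hn : 1 ≤ n) (p t AΓ CΓ δΓ : ℝ)
    (hp : 1 ≤ p) (ht : 0 ≤ t) (htn : t < n) (hAΓ : 1 ≤ AΓ) (hCΓ : 1 ≤ CΓ)
    (hδΓ0 : 0 < δΓ) (hδΓ1 : δΓ < 1)
    (Ω : Set (Euc n)) (hΩo : IsOpen Ω) (hΩne : Ω.Nonempty) (hfr : (frontier Ω).Nonempty)
    (Γ : Set (Euc n)) (hΓmeas : MeasurableSet Γ) (hΓfr : Γ ⊆ frontier Ω)
    (θΓ : Euc n → ℝ) (hθ1 : ∀ xb, 1 ≤ θΓ xb) (hθb : ∃ b : ℝ, ∀ xb, θΓ xb ≤ b)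
    (s : Euc n → ℝ) (hsm : Measurable s) (hs0 : ∀ x, 0 ≤ s x) (hsb : ∃ b : ℝ, ∀ x, s x ≤ b)
    (lam₀ η₀ : ℝ) (hlam₀ : 0 < lam₀) (hlam₀1 : lam₀ < 1) (hη₀ : 0 < η₀) (hη₀1 : η₀ < 1)
    (H1 : ∀ xb ∈ Γ, IsCorkscrew Ω (Qreg Ω lam₀ (θΓ xb) xb) xb η₀ (θΓ xb) δΓ)
    (ε : ℝ → ℝ) (hεmono : ∀ a b : ℝ, 0 < a → a ≤ b → b < 1 → ε a ≤ ε b)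
    (H2 : ∀ xb ∈ Γ, ConnectedTo Ω (Ω ∩ ball xb δΓ) xb CΓ (θΓ xb) (δΓ / (3 * CΓ)) ε)
    (H4' : ∀ xb ∈ Γ, ∀ ρ : ℝ, 0 < ρ → μH[t] (Γ ∩ ball xb ρ) ≤ ENNReal.ofReal (AΓ * ρ ^ t))
    (hΓfin : μH[t] Γ < ⊤)
    (αΓ : ℝ) (hαΓglb : IsGLB ((fun xb => alphaLow Ω s p θΓ xb δΓ) '' Γ) αΓ)
    (H3'' : -t < αΓ)
    (β : ℝ) (hβ0 : 0 < β) (hβ : β < (αΓ + t) / p) :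
    ∃ C : ℝ, 0 < C ∧
      ∀ (u : Euc n → ℝ), MemN Ω s p u →
      ∀ (Tu : Euc n → ℝ), AEMeasurable Tu (μH[t].restrict Γ) →
        (∀ᵐ xb ∂(μH[t].restrict Γ),
          Tendsto (gFun Ω u) (𝓝[Qreg Ω lam₀ (θΓ xb) xb] xb) (𝓝 (Tu xb))) →
        (∫⁻ xb in Γ, ENNReal.ofReal (|Tu xb| ^ p) ∂μH[t]) < ⊤ ∧
        (∫⁻ xb in Γ, ∫⁻ yb in Γ,
            ENNReal.ofReal (|Tu yb - Tu xb| ^ p / dist yb xb ^ (t + β * p)) ∂μH[t] ∂μH[t]) < ⊤ ∧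
        (∫⁻ xb in Γ, ENNReal.ofReal (|Tu xb| ^ p) ∂μH[t]) ^ (1 / p : ℝ) +
            (∫⁻ xb in Γ, ∫⁻ yb in Γ,
                ENNReal.ofReal (|Tu yb - Tu xb| ^ p / dist yb xb ^ (t + β * p))
                  ∂μH[t] ∂μH[t]) ^ (1 / p : ℝ) ≤
          ENNReal.ofReal (C * ((∫ x in Ω, |u x|) + nuM Ω s p u univ ^ (1 / p))) := by
  have hp0 : 0 < p := by linarith
  have hβ2 : β * p < αΓ + t := (lt_div_iff₀ hp0).1 hβ
  set β' := (β + (αΓ + t) / p) / 2 with hβ'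
  have hββ' : β < β' := by rw [hβ']; linarith
  have hβ'2 : β' * p < αΓ + t := by
    rw [← lt_div_iff₀ hp0, hβ']; linarith
  have hβ'0 : 0 < β' := by linarith
  set ρ0 := δΓ / (3 * CΓ) with hρ0_def
  have hρ0 : 0 < ρ0 := by positivity
  obtain ⟨A, hA0, hA⟩ := pointwise_est n p CΓ δΓ hp hCΓ hδΓ0 hδΓ1 Ω hΩo Γ hΓfr θΓ hθ1 hθb s hs0
    hsb lam₀ η₀ hη₀ hη₀1 H1 ε H2 αΓ (fun xb hxb => hαΓglb.1 ⟨xb, hxb, rfl⟩) β' hβ'0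
  obtain ⟨S, hS0, hS⟩ := kker_int hAΓ H4' hρ0 (κ := (β' - β) * p)
    (mul_pos (by linarith) hp0)
  obtain ⟨S3, hS30, hS3⟩ := Ffun_int hΓfin hAΓ H4' hρ0 (κ := αΓ + t - β' * p)
    (K := 2 * (1 + CΓ)) (by linarith) (by positivity)
  have hfin : IsFiniteMeasure ((μH[t] : Measure (Euc n)).restrict Γ) := ⟨by simpa using hΓfin⟩
  obtain ⟨C1, hC1⟩ : ∃ C1, C1 = 1 + (2 * A) ^ p + (2 * A) ^ p * 4 ^ (t + β * p) +
      2 ^ p * (2 * A) ^ p / (rhoS ρ0 1) ^ (t + β * p) := ⟨_, rfl⟩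
  have hC10 : 0 ≤ C1 := by
    have := rhoS_pos hρ0 1
    rw [hC1]; positivity
  set h := (μH[t] Γ).toReal with hh
  have hh0 : 0 ≤ h := ENNReal.toReal_nonneg
  have hhe : μH[t] Γ = ENNReal.ofReal h := (ENNReal.ofReal_toReal hΓfin.ne).symm
  set Ca := C1 * (S3 + h) with hCa
  set Cb := C1 * (2 * ((S + h) * (S3 + h))) with hCb
  have hCa0 : 0 ≤ Ca := by positivity
  have hCb0 : 0 ≤ Cb := by positivity
  refine ⟨Ca ^ (1 / p) + Cb ^ (1 / p) + 1, by positivity, ?_⟩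
  intro u hu Tu _ hTu
  have hNfin := NM_fin hu
  have hNu := NM_univ hu
  set V := nuM Ω s p u univ with hV
  have hV0 : 0 ≤ V := integral_nonneg fun x => nuInt_nonneg _ _ _ _ _
  set U := ∫ x in Ω, |u x| with hU
  have hU0 : 0 ≤ U := integral_nonneg fun _ => abs_nonneg _
  obtain ⟨F, hF⟩ : ∃ F, F = Ffun (NM Ω s p u) ρ0 (2 * (1 + CΓ)) (αΓ - β' * p) := ⟨_, rfl⟩
  obtain ⟨hP1, hP2⟩ := hA u hu Tu F hF
  have hFm : Measurable F := hF ▸ measurable_Ffun _ _ _ _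
  have hFint : ∫⁻ x in Γ, F x ∂μH[t] ≤ ENNReal.ofReal S3 * ENNReal.ofReal V := by
    have := hS3 (NM Ω s p u) hNfin
    have e : αΓ + t - β' * p - t = αΓ - β' * p := by ring
    rw [e, ← hF, hNu] at this
    exact this
  set G : Euc n → ℝ≥0∞ := fun x => F x + ENNReal.ofReal (U ^ p) with hG
  have hGm : Measurable G := hFm.add_const _
  have hGint : ∫⁻ x in Γ, G x ∂μH[t] ≤
      ENNReal.ofReal (S3 + h) * (ENNReal.ofReal V + ENNReal.ofReal (U ^ p)) := by
    rw [hG, lintegral_add_right _ measurable_const, setLIntegral_const, hhe,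
      ENNReal.ofReal_add hS30 hh0, mul_add]
    refine add_le_add (hFint.trans ?_) ?_
    · gcongr; exact le_self_add
    · rw [mul_comm]; gcongr; exact le_add_self
  have hgood : ∀ᵐ x ∂((μH[t] : Measure (Euc n)).restrict Γ), x ∈ Γ ∧
      Tendsto (gFun Ω u) (𝓝[Qreg Ω lam₀ (θΓ x) x] x) (𝓝 (Tu x)) := by
    filter_upwards [hTu, ae_restrict_mem hΓmeas] with x h1 h2 using ⟨h2, h1⟩
  have hest : ∀ x y, (x ∈ Γ ∧ Tendsto (gFun Ω u) (𝓝[Qreg Ω lam₀ (θΓ x) x] x) (𝓝 (Tu x))) →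
      (y ∈ Γ ∧ Tendsto (gFun Ω u) (𝓝[Qreg Ω lam₀ (θΓ y) y] y) (𝓝 (Tu y))) → _ := fun x y hx hy =>
    integrand_est (t := t) (β := β) (β' := β') (F := F) (T := Tu) (x := x) (y := y) hp hρ0 ht hβ0
      hA0 hU0 hC1 (hP1 x hx.1 hx.2) (hP1 y hy.1 hy.2) (hP2 x hx.1 y hy.1 hx.2 hy.2)
  have hI1 : (∫⁻ xb in Γ, ENNReal.ofReal (|Tu xb| ^ p) ∂μH[t]) ≤
      ENNReal.ofReal Ca * (ENNReal.ofReal V + ENNReal.ofReal (U ^ p)) := by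
    calc _ ≤ ∫⁻ x in Γ, ENNReal.ofReal C1 * G x ∂μH[t] := by
          refine lintegral_mono_ae ?_
          filter_upwards [hgood] with x hx using (hest x x hx hx).1
      _ = ENNReal.ofReal C1 * ∫⁻ x in Γ, G x ∂μH[t] := lintegral_const_mul _ hGm
      _ ≤ _ := by
          rw [hCa, ENNReal.ofReal_mul hC10, mul_assoc]
          gcongr
  have hI2 : (∫⁻ xb in Γ, ∫⁻ yb in Γ,
      ENNReal.ofReal (|Tu yb - Tu xb| ^ p / dist yb xb ^ (t + β * p)) ∂μH[t] ∂μH[t]) ≤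
      ENNReal.ofReal Cb * (ENNReal.ofReal V + ENNReal.ofReal (U ^ p)) := by
    have hdi := double_int (H := (μH[t] : Measure (Euc n)).restrict Γ) (S := S)
      (measurable_kker ρ0 ((β' - β) * p - t)) (kker_symm _ _)
      (by filter_upwards [hgood] with x hx using hS x hx.1) hGm
    calc _ ≤ ∫⁻ x in Γ, ENNReal.ofReal C1 * ∫⁻ y in Γ,
            (kker ρ0 ((β' - β) * p - t) x y + 1) * (G x + G y) ∂μH[t] ∂μH[t] := by
          refine lintegral_mono_ae ?_
          filter_upwards [hgood] with x hx
          rw [← lintegral_const_mul' _ _ ENNReal.ofReal_ne_top]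
          refine lintegral_mono_ae ?_
          filter_upwards [hgood] with y hy using (hest x y hx hy).2
      _ = ENNReal.ofReal C1 * ∫⁻ x in Γ, ∫⁻ y in Γ,
            (kker ρ0 ((β' - β) * p - t) x y + 1) * (G x + G y) ∂μH[t] ∂μH[t] :=
          lintegral_const_mul' _ _ ENNReal.ofReal_ne_top
      _ ≤ ENNReal.ofReal C1 * (2 * ((ENNReal.ofReal S + ENNReal.ofReal h) *
            (ENNReal.ofReal (S3 + h) * (ENNReal.ofReal V + ENNReal.ofReal (U ^ p))))) := by
          gcongr
          refine hdi.trans ?_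
          rw [Measure.restrict_apply_univ, hhe]
          gcongr
      _ = _ := by
          rw [hCb, ENNReal.ofReal_mul hC10, ENNReal.ofReal_mul (by norm_num),
            ENNReal.ofReal_mul (by positivity), ENNReal.ofReal_add hS0 hh0]
          norm_num
          ring
  have hfinite : ENNReal.ofReal V + ENNReal.ofReal (U ^ p) < ⊤ :=
    ENNReal.add_lt_top.2 ⟨ENNReal.ofReal_lt_top, ENNReal.ofReal_lt_top⟩
  refine ⟨hI1.trans_lt (ENNReal.mul_lt_top ENNReal.ofReal_lt_top hfinite),
    hI2.trans_lt (ENNReal.mul_lt_top ENNReal.ofReal_lt_top hfinite), ?_⟩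
  refine (add_le_add (root_est hp hCa0 hV0 hU0 hI1) (root_est hp hCb0 hV0 hU0 hI2)).trans ?_
  rw [← ENNReal.ofReal_add (by positivity) (by positivity)]
  refine ENNReal.ofReal_le_ofReal ?_
  have : 0 ≤ U + V ^ (1 / p) := by positivity
  linarith
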